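/- arXiv:1706.08632 — 4 statements merged into one kernel-verified Lean document; each statement's English description precedes it below -/
import Mathlib

section
/- Derivative bound for the cosine difference quotient (eq. (2.3.6)). Fix a ∈ ℝ and define h_a(x) = (cos x − cos a)/(x − a) for x ≠ a. Then for every x ≠ a, the derivative h_a'(x) = (−(x − a) sin x − (cos x − cos a))/(x − a)² satisfies |h_a'(x)| < 1. -/
theorem Real.sub_sq_div_two_le_sin {t : ℝ} (ht : 0 ≤ t) : t - t ^ 2 / 2 ≤ Real.sin t := by
  have hd : ∀ s : ℝ, HasDerivAt (fun s : ℝ => Real.sin s - s + s ^ 2 / 2)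
      (Real.cos s - 1 + s) s := fun s => by
    refine (((Real.hasDerivAt_sin s).sub (hasDerivAt_id s)).add
      ((hasDerivAt_pow 2 s).div_const 2)).congr_deriv ?_
    norm_num
  have hm : MonotoneOn (fun s : ℝ => Real.sin s - s + s ^ 2 / 2) (Set.Ici 0) := by
    refine monotoneOn_of_hasDerivWithinAt_nonneg (convex_Ici 0)
      (fun s _ => (hd s).continuousAt.continuousWithinAt)
      (fun s _ => (hd s).hasDerivWithinAt) fun s hs => ?_
    rw [interior_Ici, Set.mem_Ioi] at hs
    rcases le_total s 2 with h | h
    · nlinarith [Real.one_sub_sq_div_two_le_cos (x := s)]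
    · linarith [Real.neg_one_le_cos s]
  have := hm (Set.mem_Ici.2 le_rfl) (Set.mem_Ici.2 ht) ht
  norm_num at this
  linarith

theorem Real.abs_sub_sin_le_sq_div_two (t : ℝ) : |t - Real.sin t| ≤ t ^ 2 / 2 := by
  rcases le_total 0 t with h | h
  · rw [abs_of_nonneg (by linarith [Real.sin_le h])]
    linarith [Real.sub_sq_div_two_le_sin h]
  · have h₀ := Real.sin_le (neg_nonneg.2 h)
    have h₁ := Real.sub_sq_div_two_le_sin (neg_nonneg.2 h)
    rw [Real.sin_neg] at h₀ h₁
    rw [abs_of_nonpos (by linarith)]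
    linarith [neg_sq t]

/-- Eq. (2.3.6): for fixed `a`, the difference quotient
`h_a (x) = (cos x - cos a)/(x - a)` has, at each `x ≠ a`, derivative
`(-(x - a) sin x - (cos x - cos a))/(x - a)²`, whose absolute value is `< 1`. -/
theorem deriv_bound_cos_difference_quotient (a x : ℝ) (hx : x ≠ a) :
    HasDerivAt (fun z : ℝ => (Real.cos z - Real.cos a) / (z - a))
      ((-(x - a) * Real.sin x - (Real.cos x - Real.cos a)) / (x - a) ^ 2) x ∧
    |(-(x - a) * Real.sin x - (Real.cos x - Real.cos a)) / (x - a) ^ 2| < 1 := by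
  have hne : x - a ≠ 0 := sub_ne_zero.2 hx
  constructor
  · refine (((Real.hasDerivAt_cos x).sub_const (Real.cos a)).div
      ((hasDerivAt_id x).sub_const a) hne).congr_deriv ?_
    simp only [id]
    ring
  · obtain ⟨t, rfl⟩ : ∃ t, a = x - t := ⟨x - a, by ring⟩
    rw [sub_sub_cancel] at hne ⊢
    have ht : 0 < t ^ 2 := by positivity
    rw [abs_div, abs_of_pos ht, div_lt_one ht, Real.cos_sub]
    have hN : -t * Real.sin x -
        (Real.cos x - (Real.cos x * Real.cos t + Real.sin x * Real.sin t)) =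
        -(Real.cos x * (1 - Real.cos t) + Real.sin x * (t - Real.sin t)) := by ring
    rw [hN, abs_neg]
    refine abs_lt_of_sq_lt_sq ?_ ht.le
    have hs : (t - Real.sin t) ^ 2 ≤ (t ^ 2 / 2) ^ 2 :=
      sq_le_sq' (abs_le.1 (Real.abs_sub_sin_le_sq_div_two t)).1
        (abs_le.1 (Real.abs_sub_sin_le_sq_div_two t)).2
    have hc : (1 - Real.cos t) ^ 2 ≤ (t ^ 2 / 2) ^ 2 :=
      pow_le_pow_left₀ (by linarith [Real.cos_le_one t])
        (by linarith [Real.one_sub_sq_div_two_le_cos (x := t)]) 2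
    have hcs : (Real.cos x * (1 - Real.cos t) + Real.sin x * (t - Real.sin t)) ^ 2 ≤
        (1 - Real.cos t) ^ 2 + (t - Real.sin t) ^ 2 := by
      calc _ ≤ (Real.cos x ^ 2 + Real.sin x ^ 2) *
            ((1 - Real.cos t) ^ 2 + (t - Real.sin t) ^ 2) := by
            nlinarith [sq_nonneg (Real.cos x * (t - Real.sin t) -
              Real.sin x * (1 - Real.cos t))]
        _ = _ := by rw [Real.cos_sq_add_sin_sq, one_mul]
    nlinarith [pow_pos ht 2]
end

section
/- Lipschitz bound for the cosine difference quotient (eq. (2.3.7)). Fix a ∈ ℝ and let h_a : ℝ → ℝ be defined by h_a(x) = (cos x − cos a)/(x − a) for x ≠ a and h_a(a) = −sin a. Then for all x, y ∈ ℝ with x ≠ y, |h_a(x) − h_a(y)| < |x − y|. -/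
/-- The extended difference quotient of cosine at `a` is the average of `-sin` over the segment
from `a` to `x`. -/
theorem cos_difference_quotient_eq_integral (a x : ℝ) :
    (if x = a then -Real.sin a else (Real.cos x - Real.cos a) / (x - a))
      = ∫ t in (0 : ℝ)..1, -Real.sin (a + t * (x - a)) := by
  split_ifs with h
  · simp [h]
  · have hxa : x - a ≠ 0 := sub_ne_zero.mpr h
    have hderiv : ∀ t ∈ Set.uIcc (0 : ℝ) 1,
        HasDerivAt (fun t => Real.cos (a + t * (x - a)) / (x - a))
          (-Real.sin (a + t * (x - a))) t := by
      intro t _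
      have hlin : HasDerivAt (fun t : ℝ => a + t * (x - a)) (x - a) t := by
        simpa using ((hasDerivAt_id t).mul_const (x - a)).const_add a
      have hcos := hlin.cos.div_const (x - a)
      rwa [mul_div_cancel_right₀ _ hxa] at hcos
    rw [intervalIntegral.integral_eq_sub_of_hasDerivAt hderiv
      (Continuous.intervalIntegrable (by fun_prop) _ _)]
    simp [sub_div]

/-- The sine function is `1`-Lipschitz. -/
theorem abs_sin_sub_sin_le_abs_sub (u v : ℝ) : |Real.sin u - Real.sin v| ≤ |u - v| := by
  simpa using Convex.norm_image_sub_le_of_norm_hasDerivWithin_le (C := 1) (s := Set.univ)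
    (fun z _ => (Real.hasDerivAt_sin z).hasDerivWithinAt)
    (fun z _ => by simpa using Real.abs_cos_le_one z) convex_univ
    (Set.mem_univ v) (Set.mem_univ u)


/-- Eq. (2.3.7): for fixed `a`, the continuous extension of the difference
quotient of cosine, `h_a (x) = (cos x - cos a)/(x - a)` for `x ≠ a` and
`h_a (a) = -sin a`, satisfies `|h_a (x) - h_a (y)| < |x - y|` for `x ≠ y`. -/
theorem lipschitz_bound_cos_difference_quotient (a : ℝ) :
    ∀ x y : ℝ, x ≠ y →
      |(if x = a then -Real.sin a else (Real.cos x - Real.cos a) / (x - a))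
          - (if y = a then -Real.sin a else (Real.cos y - Real.cos a) / (y - a))|
        < |x - y| := by
  intro x y hxy
  have hpos : 0 < |x - y| := abs_pos.mpr (sub_ne_zero.mpr hxy)
  rw [cos_difference_quotient_eq_integral, cos_difference_quotient_eq_integral,
    ← intervalIntegral.integral_sub (Continuous.intervalIntegrable (by fun_prop) _ _)
      (Continuous.intervalIntegrable (by fun_prop) _ _)]
  have hbound : ∀ t ∈ Set.Ioc (0 : ℝ) 1,
      ‖-Real.sin (a + t * (x - a)) - -Real.sin (a + t * (y - a))‖ ≤ t * |x - y| := by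
    intro t ht
    calc ‖-Real.sin (a + t * (x - a)) - -Real.sin (a + t * (y - a))‖
        = |Real.sin (a + t * (x - a)) - Real.sin (a + t * (y - a))| := by
          rw [Real.norm_eq_abs, ← abs_neg]; ring_nf
      _ ≤ |(a + t * (x - a)) - (a + t * (y - a))| := abs_sin_sub_sin_le_abs_sub _ _
      _ = |t * (x - y)| := by ring_nf
      _ = t * |x - y| := by rw [abs_mul, abs_of_pos ht.1]
  have hle := intervalIntegral.norm_integral_le_of_norm_le (μ := MeasureTheory.volume)
    zero_le_one (Filter.Eventually.of_forall hbound)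
    (Continuous.intervalIntegrable (by fun_prop) _ _)
  rw [intervalIntegral.integral_mul_const, integral_id, Real.norm_eq_abs] at hle
  linarith
end

section
/- Midpoint expansion of difference quotients (eq. (3.1.3), with the corrected third derivative). Let f : ℝ → ℝ be five times continuously differentiable and let ξ, η ∈ ℝ with ξ ≠ η, and set m = (ξ + η)/2. Then |(f(ξ) − f(η))/(ξ − η) − f'(m) − (1/24) f'''(m) (ξ − η)²| ≤ (K/1920) |ξ − η|⁴, where K is the supremum of |f⁽⁵⁾| on the closed interval with endpoints ξ and η. -/
open Set in
/-- **Taylor's theorem** with Lagrange remainder for a function smooth on all of `ℝ`, with the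
Taylor polynomial written in terms of the global iterated derivatives. -/
theorem exists_eq_sum_iteratedDeriv_add_lagrange {f : ℝ → ℝ} {n : ℕ}
    (hf : ContDiff ℝ (n + 1) f) {x₀ x : ℝ} (hx : x₀ ≠ x) :
    ∃ y ∈ uIoo x₀ x, f x =
      ∑ k ∈ Finset.range (n + 1), iteratedDeriv k f x₀ * (x - x₀) ^ k / k.factorial
        + iteratedDeriv (n + 1) f y * (x - x₀) ^ (n + 1) / (n + 1).factorial := by
  obtain ⟨y, hy, h⟩ := taylor_mean_remainder_lagrange_iteratedDeriv hx hf.contDiffOn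
  refine ⟨y, hy, ?_⟩
  rw [← h, taylor_within_apply, ← sub_eq_iff_eq_add']
  congr 1
  refine Finset.sum_congr rfl fun k hk ↦ ?_
  have hk' : (k : WithTop ℕ∞) ≤ n + 1 := by
    exact_mod_cast (Finset.mem_range.1 hk).le
  rw [iteratedDerivWithin_eq_iteratedDeriv (uniqueDiffOn_uIcc hx)
    (hf.of_le hk').contDiffAt left_mem_uIcc, smul_eq_mul]
  ring

/-- Eq. (3.1.3) (with the corrected third derivative): midpoint expansion of
the difference quotient of a `C⁵` function, with remainder controlled by the
supremum `K` of `|f⁽⁵⁾|` on the closed interval with endpoints `ξ` and `η`. -/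
theorem midpoint_expansion_difference_quotient
    (f : ℝ → ℝ) (hf : ContDiff ℝ 5 f) (ξ η : ℝ) (hne : ξ ≠ η) :
    |(f ξ - f η) / (ξ - η) - deriv f ((ξ + η) / 2)
        - (1 / 24) * iteratedDeriv 3 f ((ξ + η) / 2) * (ξ - η) ^ 2|
      ≤ (sSup ((fun x => |iteratedDeriv 5 f x|) '' Set.uIcc ξ η)) / 1920
          * |ξ - η| ^ 4 := by
  have hd : ξ - η ≠ 0 := sub_ne_zero.2 hne
  set m := (ξ + η) / 2 with hm
  set K := sSup ((fun x => |iteratedDeriv 5 f x|) '' Set.uIcc ξ η)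
  have hK : ∀ y ∈ Set.uIcc ξ η, |iteratedDeriv 5 f y| ≤ K := fun y hy ↦
    le_csSup (isCompact_uIcc.image (hf.continuous_iteratedDeriv 5 le_rfl).abs).bddAbove
      ⟨y, hy, rfl⟩
  have hmem : m ∈ Set.uIcc ξ η := by
    rw [Set.mem_uIcc]
    rcases le_total ξ η with h | h
    · left; constructor <;> linarith
    · right; constructor <;> linarith
  have hf' : ContDiff ℝ ((4 : ℕ) + 1) f := by
    convert hf using 1
    norm_num
  obtain ⟨y, hy, hy'⟩ := exists_eq_sum_iteratedDeriv_add_lagrange hf' (x₀ := m) (x := ξ)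
    fun h ↦ hd (by linarith)
  obtain ⟨z, hz, hz'⟩ := exists_eq_sum_iteratedDeriv_add_lagrange hf' (x₀ := m) (x := η)
    fun h ↦ hd (by linarith)
  have hyK := hK y (Set.uIcc_subset_uIcc hmem Set.left_mem_uIcc (Set.uIoo_subset_uIcc_self hy))
  have hzK := hK z (Set.uIcc_subset_uIcc hmem Set.right_mem_uIcc (Set.uIoo_subset_uIcc_self hz))
  have hξ : ξ - m = (ξ - η) / 2 := by rw [hm]; ring
  have hη : η - m = -((ξ - η) / 2) := by rw [hm]; ring
  rw [hξ] at hy'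
  rw [hη] at hz'
  have key : (f ξ - f η) / (ξ - η) - deriv f m - (1 / 24) * iteratedDeriv 3 f m * (ξ - η) ^ 2
      = (iteratedDeriv 5 f y + iteratedDeriv 5 f z) / 3840 * (ξ - η) ^ 4 := by
    rw [hy', hz']
    simp only [Finset.sum_range_succ, Finset.sum_range_zero, iteratedDeriv_one, Nat.factorial]
    push_cast
    field_simp
    ring
  rw [key, abs_mul, abs_pow]
  gcongr
  rw [abs_div, abs_of_pos (by norm_num : (0 : ℝ) < 3840)]
  linarith [abs_add_le (iteratedDeriv 5 f y) (iteratedDeriv 5 f z)]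
end

section
/- Truncation error of the scheme (Lemma 4.1). Let α, β ≥ 0, φ₀ ≥ 0, T > 0, L > 0, and let φ : ℝ² → ℝ satisfy |φ(x,y)| ≤ φ₀. Let u_e : ℝ² × ℝ → ℝ be of class C⁵, set v_e = ∂_t u_e, and define F : ℝ² × ℝ → ℝ by F = ∂_{tt} u_e + β ∂_t u_e − α Δ u_e + φ sin u_e (so that u_e is an exact solution of the damped sine-Gordon equation with forcing F). For an integer M ≥ 2 set h = L/M, x_i = i·h, y_j = j·h, and for Δt > 0 set t^k = k·Δt and u_e^k(i,j) = u_e(x_i, y_j, t^k), v_e^k(i,j) = v_e(x_i, y_j, t^k). Define the truncation errors at interior points (1 ≤ i,j ≤ M−1) by ρ^k_{i,j} = (v_e^{k+1} − v_e^k)_{i,j}/Δt + β (u_e^{k+1} − u_e^k)_{i,j}/Δt − (α/2)(Δ_h(u_e^{k+1} + u_e^k))_{i,j} − φ(x_i,y_j) H((u_e^{k+1})_{i,j}, (u_e^k)_{i,j}) − F(x_i, y_j, t^k + Δt/2) and s^k_{i,j} = (u_e^{k+1} − u_e^k)_{i,j}/Δt − ((v_e^{k+1} + v_e^k)_{i,j})/2.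 Then there exists a constant C, depending only on u_e, φ₀, α, β, L, and T, such that for all 0 < h ≤ 1, 0 < Δt ≤ 1, all k with (k+1)Δt ≤ T, and all interior (i,j): |ρ^k_{i,j}| + |s^k_{i,j}| ≤ C (Δt² + h²). -/
/-- Continuous extension of the divided difference of cosine:
`H (x, y) = (cos x - cos y)/(x - y)` for `x ≠ y` and `H (x, x) = -sin x`. -/
noncomputable def Hcos (x y : ℝ) : ℝ :=
  if x = y then -Real.sin x else (Real.cos x - Real.cos y) / (x - y)

/-- Standard five-point discrete Laplacian with mesh size `h`. -/
noncomputable def lapH (h : ℝ) (w : ℕ → ℕ → ℝ) (i j : ℕ) : ℝ :=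
  (w (i + 1) j - 2 * w i j + w (i - 1) j) / h ^ 2
    + (w i (j + 1) - 2 * w i j + w i (j - 1)) / h ^ 2

/-- The forcing term `F = ∂ₜₜ uₑ + β ∂ₜ uₑ - α Δ uₑ + φ sin uₑ`, so that `uₑ`
is an exact solution of the damped sine-Gordon equation with forcing `F`. -/
noncomputable def Fforce (α β : ℝ) (φ : ℝ → ℝ → ℝ) (ue : ℝ → ℝ → ℝ → ℝ)
    (x y t : ℝ) : ℝ :=
  iteratedDeriv 2 (ue x y) t + β * deriv (ue x y) t
    - α * (iteratedDeriv 2 (fun z => ue z y t) x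
            + iteratedDeriv 2 (fun z => ue x z t) y)
    + φ x y * Real.sin (ue x y t)

open Set

section CentredDifferences

/-- A function vanishing at `0` whose derivative is bounded by `C` on `[0, r]` is bounded by
`C * r` at `r`. -/
lemma abs_le_mul_of_hasDerivAt {g g' : ℝ → ℝ} (hg : ∀ s, HasDerivAt g (g' s) s) (h0 : g 0 = 0)
    {C r : ℝ} (hr : 0 ≤ r) (hC : ∀ s, 0 ≤ s → s ≤ r → |g' s| ≤ C) : |g r| ≤ C * r := by
  have h := Convex.norm_image_sub_le_of_norm_hasDerivWithin_le (s := Icc 0 r) (C := C)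
    (fun s _ => (hg s).hasDerivWithinAt) (fun s hs => hC s hs.1 hs.2) (convex_Icc 0 r)
    (left_mem_Icc.2 hr) (right_mem_Icc.2 hr)
  simpa [h0, abs_of_nonneg hr] using h

variable {f f₁ f₂ f₃ f₄ : ℝ → ℝ} {B r : ℝ}

lemma HasDerivAt.comp_neg_arg (h1 : ∀ s, HasDerivAt f (f₁ s) s) (s : ℝ) :
    HasDerivAt (fun s => f (-s)) (-f₁ (-s)) s := by
  simpa [Function.comp_def] using (h1 (-s)).comp s (hasDerivAt_neg s)

lemma abs_centred_sub_le (h1 : ∀ s, HasDerivAt f (f₁ s) s) (hr : 0 ≤ r)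
    (hB : ∀ s, |s| ≤ r → |f₁ s| ≤ B) : |f r - f (-r)| ≤ 2 * B * r := by
  refine abs_le_mul_of_hasDerivAt (g := fun s => f s - f (-s)) (g' := fun s => f₁ s - -f₁ (-s))
    (fun s => (h1 s).sub (HasDerivAt.comp_neg_arg h1 s)) (by simp) hr fun s hs hsr => ?_
  have hb := hB s (by rwa [abs_of_nonneg hs])
  have hb' := hB (-s) (by rwa [abs_neg, abs_of_nonneg hs])
  rw [abs_le] at *
  constructor <;> linarith

lemma abs_centred_add_sub_le (h1 : ∀ s, HasDerivAt f (f₁ s) s) (h2 : ∀ s, HasDerivAt f₁ (f₂ s) s)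
    (hr : 0 ≤ r) (hB : ∀ s, |s| ≤ r → |f₂ s| ≤ B) :
    |f r + f (-r) - 2 * f 0| ≤ 2 * B * r ^ 2 := by
  have hB0 : 0 ≤ B := (abs_nonneg _).trans (hB 0 (by simpa using hr))
  have h := abs_le_mul_of_hasDerivAt (C := 2 * B * r) (g := fun s => f s + f (-s) - 2 * f 0)
    (g' := fun s => f₁ s + -f₁ (-s))
    (fun s => ((h1 s).add (HasDerivAt.comp_neg_arg h1 s)).sub_const _) (by simp; ring) hr
    fun s hs hsr => by
      have h := abs_centred_sub_le h2 hs fun u hu => hB u (hu.trans hsr)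
      rw [sub_eq_add_neg] at h
      exact h.trans (by gcongr)
  exact h.trans_eq (by ring)

lemma abs_centred_sub_sub_deriv_le (h1 : ∀ s, HasDerivAt f (f₁ s) s)
    (h2 : ∀ s, HasDerivAt f₁ (f₂ s) s) (h3 : ∀ s, HasDerivAt f₂ (f₃ s) s)
    (hr : 0 ≤ r) (hB : ∀ s, |s| ≤ r → |f₃ s| ≤ B) :
    |f r - f (-r) - 2 * r * f₁ 0| ≤ 2 * B * r ^ 3 := by
  have hB0 : 0 ≤ B := (abs_nonneg _).trans (hB 0 (by simpa using hr))
  have h := abs_le_mul_of_hasDerivAt (C := 2 * B * r ^ 2)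
    (g := fun s => f s - f (-s) - s * (2 * f₁ 0))
    (g' := fun s => f₁ s - -f₁ (-s) - 1 * (2 * f₁ 0))
    (fun s => ((h1 s).sub (HasDerivAt.comp_neg_arg h1 s)).sub ((hasDerivAt_id s).mul_const _))
    (by simp) hr
    fun s hs hsr => by
      have h := abs_centred_add_sub_le h2 h3 hs fun u hu => hB u (hu.trans hsr)
      rw [sub_neg_eq_add, one_mul]
      exact h.trans (by gcongr)
  calc |f r - f (-r) - 2 * r * f₁ 0| = |f r - f (-r) - r * (2 * f₁ 0)| := by ring_nf
    _ ≤ _ := h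
    _ = _ := by ring

lemma abs_centred_add_sub_deriv_le (h1 : ∀ s, HasDerivAt f (f₁ s) s)
    (h2 : ∀ s, HasDerivAt f₁ (f₂ s) s) (h3 : ∀ s, HasDerivAt f₂ (f₃ s) s)
    (h4 : ∀ s, HasDerivAt f₃ (f₄ s) s) (hr : 0 ≤ r) (hB : ∀ s, |s| ≤ r → |f₄ s| ≤ B) :
    |f r + f (-r) - 2 * f 0 - r ^ 2 * f₂ 0| ≤ 2 * B * r ^ 4 := by
  have hB0 : 0 ≤ B := (abs_nonneg _).trans (hB 0 (by simpa using hr))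
  have h := abs_le_mul_of_hasDerivAt (C := 2 * B * r ^ 3)
    (g := fun s => f s + f (-s) - 2 * f 0 - s ^ 2 * f₂ 0)
    (g' := fun s => f₁ s + -f₁ (-s) - (2 * s) * f₂ 0)
    (fun s => (((h1 s).add (HasDerivAt.comp_neg_arg h1 s)).sub_const _).sub
      (by simpa using (hasDerivAt_pow 2 s).mul_const (f₂ 0)))
    (by simp; ring) hr
    fun s hs hsr => by
      have h := abs_centred_sub_sub_deriv_le h2 h3 h4 hs fun u hu => hB u (hu.trans hsr)
      rw [sub_eq_add_neg (f₁ s)] at h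
      exact h.trans (by gcongr)
  exact h.trans_eq (by ring)

end CentredDifferences

lemma IsCompact.exists_nonneg_abs_bound {E : Type*} [TopologicalSpace E] {K : Set E} (hK : IsCompact K) {f : E → ℝ}
    (hf : Continuous f) : ∃ B, 0 ≤ B ∧ ∀ p ∈ K, |f p| ≤ B := by
  obtain ⟨B, hB⟩ := hK.exists_bound_of_continuousOn hf.continuousOn
  exact ⟨max B 0, le_max_right _ _, fun p hp => (hB p hp).trans (le_max_left _ _)⟩

section Directional

variable {E : Type*} [NormedAddCommGroup E] [NormedSpace ℝ E]

/-- The derivative of `f` in the direction `e`. -/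
noncomputable def dirDeriv (e : E) (f : E → ℝ) (p : E) : ℝ := fderiv ℝ f p e

lemma ContDiff.dirDeriv {f : E → ℝ} {m n : WithTop ℕ∞} (hf : ContDiff ℝ n f) (e : E)
    (hmn : m + 1 ≤ n) : ContDiff ℝ m (dirDeriv e f) :=
  (hf.fderiv_right hmn).clm_apply contDiff_const

lemma ContDiff.hasDerivAt_dirDeriv {f : E → ℝ} {n : WithTop ℕ∞} (hf : ContDiff ℝ n f)
    (hn : 1 ≤ n) (p e : E) (s : ℝ) :
    HasDerivAt (fun s : ℝ => f (p + s • e)) (_root_.dirDeriv e f (p + s • e)) s := by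
  have hd := (hf.differentiable (by positivity) (p + s • e)).hasFDerivAt
  have hl : HasDerivAt (fun s : ℝ => p + s • e) e s := by
    simpa using ((hasDerivAt_id s).smul_const e).const_add p
  exact hd.comp_hasDerivAt s hl

variable {K : Set E} {f : E → ℝ}

lemma exists_centred_sub_le (hK : IsCompact K) (hf : ContDiff ℝ 1 f) (e : E) :
    ∃ B, 0 ≤ B ∧ ∀ p r, 0 ≤ r → (∀ s : ℝ, |s| ≤ r → p + s • e ∈ K) →
      |f (p + r • e) - f (p + (-r) • e)| ≤ B * r := by
  obtain ⟨B, hB0, hB⟩ := hK.exists_nonneg_abs_bound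
    (hf.dirDeriv (m := 0) e (by norm_num)).continuous
  refine ⟨2 * B, by positivity, fun p r hr hp => ?_⟩
  exact abs_centred_sub_le (hf.hasDerivAt_dirDeriv le_rfl p e) hr fun s hs => hB _ (hp s hs)

lemma exists_centred_add_sub_le (hK : IsCompact K) (hf : ContDiff ℝ 2 f) (e : E) :
    ∃ B, 0 ≤ B ∧ ∀ p r, 0 ≤ r → (∀ s : ℝ, |s| ≤ r → p + s • e ∈ K) →
      |f (p + r • e) + f (p + (-r) • e) - 2 * f p| ≤ B * r ^ 2 := by
  have hf₁ := hf.dirDeriv (m := 1) e (by norm_num)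
  obtain ⟨B, hB0, hB⟩ := hK.exists_nonneg_abs_bound
    (hf₁.dirDeriv (m := 0) e (by norm_num)).continuous
  refine ⟨2 * B, by positivity, fun p r hr hp => ?_⟩
  simpa using abs_centred_add_sub_le (hf.hasDerivAt_dirDeriv (by norm_num) p e)
    (hf₁.hasDerivAt_dirDeriv le_rfl p e) hr fun s hs => hB _ (hp s hs)

lemma exists_centred_sub_sub_deriv_le (hK : IsCompact K) (hf : ContDiff ℝ 3 f) (e : E) :
    ∃ B, 0 ≤ B ∧ ∀ p r, 0 ≤ r → (∀ s : ℝ, |s| ≤ r → p + s • e ∈ K) →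
      |f (p + r • e) - f (p + (-r) • e) - 2 * r * dirDeriv e f p| ≤ B * r ^ 3 := by
  have hf₁ := hf.dirDeriv (m := 2) e (by norm_num)
  have hf₂ := hf₁.dirDeriv (m := 1) e (by norm_num)
  obtain ⟨B, hB0, hB⟩ := hK.exists_nonneg_abs_bound
    (hf₂.dirDeriv (m := 0) e (by norm_num)).continuous
  refine ⟨2 * B, by positivity, fun p r hr hp => ?_⟩
  simpa using abs_centred_sub_sub_deriv_le (hf.hasDerivAt_dirDeriv (by norm_num) p e)
    (hf₁.hasDerivAt_dirDeriv (by norm_num) p e) (hf₂.hasDerivAt_dirDeriv le_rfl p e) hr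
    fun s hs => hB _ (hp s hs)

lemma exists_centred_add_sub_deriv_le (hK : IsCompact K) (hf : ContDiff ℝ 4 f) (e : E) :
    ∃ B, 0 ≤ B ∧ ∀ p r, 0 ≤ r → (∀ s : ℝ, |s| ≤ r → p + s • e ∈ K) →
      |f (p + r • e) + f (p + (-r) • e) - 2 * f p - r ^ 2 * dirDeriv e (dirDeriv e f) p|
        ≤ B * r ^ 4 := by
  have hf₁ := hf.dirDeriv (m := 3) e (by norm_num)
  have hf₂ := hf₁.dirDeriv (m := 2) e (by norm_num)
  have hf₃ := hf₂.dirDeriv (m := 1) e (by norm_num)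
  obtain ⟨B, hB0, hB⟩ := hK.exists_nonneg_abs_bound
    (hf₃.dirDeriv (m := 0) e (by norm_num)).continuous
  refine ⟨2 * B, by positivity, fun p r hr hp => ?_⟩
  simpa using abs_centred_add_sub_deriv_le (hf.hasDerivAt_dirDeriv (by norm_num) p e)
    (hf₁.hasDerivAt_dirDeriv (by norm_num) p e) (hf₂.hasDerivAt_dirDeriv (by norm_num) p e)
    (hf₃.hasDerivAt_dirDeriv le_rfl p e) hr fun s hs => hB _ (hp s hs)

end Directional

section PartialDerivatives

variable {U : ℝ × ℝ × ℝ → ℝ}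

lemma deriv_fst_eq_dirDeriv (hU : ContDiff ℝ 1 U) (x y t : ℝ) :
    deriv (fun z => U (z, y, t)) x = dirDeriv (1, 0, 0) U (x, y, t) := by
  simpa using (hU.hasDerivAt_dirDeriv le_rfl (0, y, t) (1, 0, 0) x).deriv

lemma deriv_snd_eq_dirDeriv (hU : ContDiff ℝ 1 U) (x y t : ℝ) :
    deriv (fun z => U (x, z, t)) y = dirDeriv (0, 1, 0) U (x, y, t) := by
  simpa using (hU.hasDerivAt_dirDeriv le_rfl (x, 0, t) (0, 1, 0) y).deriv

lemma deriv_thd_eq_dirDeriv (hU : ContDiff ℝ 1 U) (x y t : ℝ) :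
    deriv (fun z => U (x, y, z)) t = dirDeriv (0, 0, 1) U (x, y, t) := by
  simpa using (hU.hasDerivAt_dirDeriv le_rfl (x, y, 0) (0, 0, 1) t).deriv

lemma iteratedDeriv_two_fst_eq_dirDeriv (hU : ContDiff ℝ 2 U) (x y t : ℝ) :
    iteratedDeriv 2 (fun z => U (z, y, t)) x
      = dirDeriv (1, 0, 0) (dirDeriv (1, 0, 0) U) (x, y, t) := by
  rw [iteratedDeriv_succ, iteratedDeriv_one,
    ← deriv_fst_eq_dirDeriv (hU.dirDeriv _ (by norm_num))]
  congr 1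
  exact funext fun z => deriv_fst_eq_dirDeriv (hU.of_le (by norm_num)) z y t

lemma iteratedDeriv_two_snd_eq_dirDeriv (hU : ContDiff ℝ 2 U) (x y t : ℝ) :
    iteratedDeriv 2 (fun z => U (x, z, t)) y
      = dirDeriv (0, 1, 0) (dirDeriv (0, 1, 0) U) (x, y, t) := by
  rw [iteratedDeriv_succ, iteratedDeriv_one,
    ← deriv_snd_eq_dirDeriv (hU.dirDeriv _ (by norm_num))]
  congr 1
  exact funext fun z => deriv_snd_eq_dirDeriv (hU.of_le (by norm_num)) x z t

lemma iteratedDeriv_two_thd_eq_dirDeriv (hU : ContDiff ℝ 2 U) (x y t : ℝ) :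
    iteratedDeriv 2 (fun z => U (x, y, z)) t
      = dirDeriv (0, 0, 1) (dirDeriv (0, 0, 1) U) (x, y, t) := by
  rw [iteratedDeriv_succ, iteratedDeriv_one,
    ← deriv_thd_eq_dirDeriv (hU.dirDeriv _ (by norm_num))]
  congr 1
  exact funext fun z => deriv_thd_eq_dirDeriv (hU.of_le (by norm_num)) x y z

end PartialDerivatives

lemma Hcos_comm (a b : ℝ) : Hcos a b = Hcos b a := by
  unfold Hcos
  rcases eq_or_ne a b with rfl | hab
  · rfl
  · rw [if_neg hab, if_neg hab.symm, ← neg_sub (Real.cos b), ← neg_sub b a, neg_div_neg_eq]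

/-- The divided difference of cosine is minus the sine of the midpoint, up to second order. -/
lemma abs_Hcos_add_sin_midpoint_le (a b : ℝ) :
    |Hcos a b + Real.sin ((a + b) / 2)| ≤ (a - b) ^ 2 := by
  wlog hab : b ≤ a generalizing a b
  · have h := this b a (le_of_not_ge hab)
    rwa [Hcos_comm, add_comm b a, ← neg_sub a b, neg_sq] at h
  rcases hab.eq_or_lt with rfl | hlt
  · simp [Hcos]
  set m := (a + b) / 2 with hm
  set r := (a - b) / 2 with hrdef
  have hr : 0 < r := by rw [hrdef]; linarith
  have hshift (s : ℝ) : HasDerivAt (fun s => m + s) 1 s := (hasDerivAt_id s).const_add m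
  have h := abs_centred_sub_sub_deriv_le (f := fun s => Real.cos (m + s))
    (f₁ := fun s => -Real.sin (m + s)) (f₂ := fun s => -Real.cos (m + s))
    (f₃ := fun s => Real.sin (m + s)) (B := 1)
    (fun s => by simpa using (hshift s).cos) (fun s => by simpa using (hshift s).sin.fun_neg)
    (fun s => by simpa using (hshift s).cos.fun_neg) hr.le (fun s _ => Real.abs_sin_le_one _)
  have ha : a = m + r := by rw [hm, hrdef]; ring
  have hb : b = m + -r := by rw [hm, hrdef]; ring
  have hdiff : a - b = 2 * r := by rw [hrdef]; ring
  have hH : Hcos a b + Real.sin m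
      = (Real.cos (m + r) - Real.cos (m + -r) - 2 * r * (-Real.sin (m + 0))) / (2 * r) := by
    rw [Hcos, if_neg hlt.ne', hdiff, ← ha, ← hb, add_zero]
    field_simp
    ring
  rw [hH, abs_div, abs_of_pos (by positivity : 0 < 2 * r), div_le_iff₀ (by positivity), hdiff]
  refine h.trans ?_
  nlinarith [pow_pos hr 3]

/-- Second-order consistency of the scheme on a box, in terms of directional derivatives. -/
lemma exists_consistency_bounds {U : ℝ × ℝ × ℝ → ℝ} (hU : ContDiff ℝ 5 U) (T L : ℝ) :
    ∃ B, 0 ≤ B ∧ ∀ x y m r h : ℝ, 0 < r → 0 < h → r ≤ m → m + r ≤ T →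
      h ≤ x → x + h ≤ L → h ≤ y → y + h ≤ L →
      |(dirDeriv (0, 0, 1) U (x, y, m + r) - dirDeriv (0, 0, 1) U (x, y, m - r)) / (2 * r)
          - dirDeriv (0, 0, 1) (dirDeriv (0, 0, 1) U) (x, y, m)| ≤ B * r ^ 2 ∧
      |(U (x, y, m + r) - U (x, y, m - r)) / (2 * r) - dirDeriv (0, 0, 1) U (x, y, m)|
        ≤ B * r ^ 2 ∧
      |(dirDeriv (0, 0, 1) U (x, y, m + r) + dirDeriv (0, 0, 1) U (x, y, m - r)) / 2
          - dirDeriv (0, 0, 1) U (x, y, m)| ≤ B * r ^ 2 ∧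
      |-Hcos (U (x, y, m + r)) (U (x, y, m - r)) - Real.sin (U (x, y, m))| ≤ B * r ^ 2 ∧
      |(U (x + h, y, m + r) + U (x + h, y, m - r) - 2 * (U (x, y, m + r) + U (x, y, m - r))
          + (U (x - h, y, m + r) + U (x - h, y, m - r))) / h ^ 2
          - 2 * dirDeriv (1, 0, 0) (dirDeriv (1, 0, 0) U) (x, y, m)| ≤ B * (r ^ 2 + h ^ 2) ∧
      |(U (x, y + h, m + r) + U (x, y + h, m - r) - 2 * (U (x, y, m + r) + U (x, y, m - r))
          + (U (x, y - h, m + r) + U (x, y - h, m - r))) / h ^ 2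
          - 2 * dirDeriv (0, 1, 0) (dirDeriv (0, 1, 0) U) (x, y, m)| ≤ B * (r ^ 2 + h ^ 2) := by
  have hK : IsCompact (Icc (0 : ℝ) L ×ˢ Icc (0 : ℝ) L ×ˢ Icc (0 : ℝ) T) :=
    isCompact_Icc.prod (isCompact_Icc.prod isCompact_Icc)
  have hV : ContDiff ℝ 4 (dirDeriv (0, 0, 1) U) := hU.dirDeriv _ (by norm_num)
  have hxx : ContDiff ℝ 3 (dirDeriv (1, 0, 0) (dirDeriv (1, 0, 0) U)) :=
    (hU.dirDeriv (m := 4) _ (by norm_num)).dirDeriv _ (by norm_num)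
  have hyy : ContDiff ℝ 3 (dirDeriv (0, 1, 0) (dirDeriv (0, 1, 0) U)) :=
    (hU.dirDeriv (m := 4) _ (by norm_num)).dirDeriv _ (by norm_num)
  obtain ⟨b₁, hb₁, H₁⟩ := exists_centred_sub_sub_deriv_le hK (hV.of_le (by norm_num)) (0, 0, 1)
  obtain ⟨b₂, hb₂, H₂⟩ := exists_centred_sub_sub_deriv_le hK (hU.of_le (by norm_num)) (0, 0, 1)
  obtain ⟨b₃, hb₃, H₃⟩ := exists_centred_add_sub_le hK (hV.of_le (by norm_num)) (0, 0, 1)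
  obtain ⟨b₄, hb₄, H₄⟩ := exists_centred_add_sub_le hK (hU.of_le (by norm_num)) (0, 0, 1)
  obtain ⟨b₅, hb₅, H₅⟩ := exists_centred_sub_le hK (hU.of_le (by norm_num)) (0, 0, 1)
  obtain ⟨b₆, hb₆, H₆⟩ := exists_centred_add_sub_deriv_le hK (hU.of_le (by norm_num)) (1, 0, 0)
  obtain ⟨b₇, hb₇, H₇⟩ := exists_centred_add_sub_deriv_le hK (hU.of_le (by norm_num)) (0, 1, 0)
  obtain ⟨b₈, hb₈, H₈⟩ := exists_centred_add_sub_le hK (hxx.of_le (by norm_num)) (0, 0, 1)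
  obtain ⟨b₉, hb₉, H₉⟩ := exists_centred_add_sub_le hK (hyy.of_le (by norm_num)) (0, 0, 1)
  refine ⟨b₁ + b₂ + b₃ + b₄ + b₅ ^ 2 + 2 * b₆ + 2 * b₇ + b₈ + b₉, by positivity, ?_⟩
  intro x y m r h hr hh hrm hmT hx hxL hy hyL
  have htK (s : ℝ) (hs : |s| ≤ r) : (x, y, m) + s • ((0, 0, 1) : ℝ × ℝ × ℝ)
      ∈ Icc (0 : ℝ) L ×ˢ Icc (0 : ℝ) L ×ˢ Icc (0 : ℝ) T := by
    rw [abs_le] at hs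
    simp only [Prod.smul_mk, Prod.mk_add_mk, smul_eq_mul, mem_prod, mem_Icc]
    refine ⟨⟨?_, ?_⟩, ⟨?_, ?_⟩, ?_, ?_⟩ <;> linarith
  have hxK (t : ℝ) (ht : 0 ≤ t) (htT : t ≤ T) (s : ℝ) (hs : |s| ≤ h) :
      (x, y, t) + s • ((1, 0, 0) : ℝ × ℝ × ℝ)
        ∈ Icc (0 : ℝ) L ×ˢ Icc (0 : ℝ) L ×ˢ Icc (0 : ℝ) T := by
    rw [abs_le] at hs
    simp only [Prod.smul_mk, Prod.mk_add_mk, smul_eq_mul, mem_prod, mem_Icc]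
    refine ⟨⟨?_, ?_⟩, ⟨?_, ?_⟩, ?_, ?_⟩ <;> linarith
  have hyK (t : ℝ) (ht : 0 ≤ t) (htT : t ≤ T) (s : ℝ) (hs : |s| ≤ h) :
      (x, y, t) + s • ((0, 1, 0) : ℝ × ℝ × ℝ)
        ∈ Icc (0 : ℝ) L ×ˢ Icc (0 : ℝ) L ×ˢ Icc (0 : ℝ) T := by
    rw [abs_le] at hs
    simp only [Prod.smul_mk, Prod.mk_add_mk, smul_eq_mul, mem_prod, mem_Icc]
    refine ⟨⟨?_, ?_⟩, ⟨?_, ?_⟩, ?_, ?_⟩ <;> linarith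
  replace H₁ := H₁ _ r hr.le htK
  replace H₂ := H₂ _ r hr.le htK
  replace H₃ := H₃ _ r hr.le htK
  replace H₄ := H₄ _ r hr.le htK
  replace H₅ := H₅ _ r hr.le htK
  have H₆p := H₆ _ h hh.le (hxK (m + r) (by linarith) (by linarith))
  have H₆m := H₆ _ h hh.le (hxK (m - r) (by linarith) (by linarith))
  have H₇p := H₇ _ h hh.le (hyK (m + r) (by linarith) (by linarith))
  have H₇m := H₇ _ h hh.le (hyK (m - r) (by linarith) (by linarith))
  replace H₈ := H₈ _ r hr.le htK
  replace H₉ := H₉ _ r hr.le htK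
  simp only [Prod.smul_mk, Prod.mk_add_mk, smul_eq_mul, mul_zero, mul_one, add_zero,
    ← sub_eq_add_neg] at H₁ H₂ H₃ H₄ H₅ H₆p H₆m H₇p H₇m H₈ H₉
  have central {a b d c : ℝ} (H : |a - b - 2 * r * d| ≤ c * r ^ 3) (hc : 0 ≤ c) :
      |(a - b) / (2 * r) - d| ≤ c * r ^ 2 := by
    have he : (a - b) / (2 * r) - d = (a - b - 2 * r * d) / (2 * r) := by field_simp
    rw [he, abs_div, abs_of_pos (by positivity : 0 < 2 * r), div_le_iff₀ (by positivity)]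
    refine H.trans ?_
    nlinarith [mul_nonneg hc (pow_pos hr 3).le]
  have second {ap am cp cm bp bm dp dm d b b' : ℝ}
      (Hp : |ap + bp - 2 * cp - h ^ 2 * dp| ≤ b * h ^ 4)
      (Hm : |am + bm - 2 * cm - h ^ 2 * dm| ≤ b * h ^ 4)
      (Hd : |dp + dm - 2 * d| ≤ b' * r ^ 2) :
      |(ap + am - 2 * (cp + cm) + (bp + bm)) / h ^ 2 - 2 * d|
        ≤ 2 * b * h ^ 2 + b' * r ^ 2 := by
    have he : (ap + am - 2 * (cp + cm) + (bp + bm)) / h ^ 2 - 2 * d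
        = ((ap + bp - 2 * cp - h ^ 2 * dp) + (am + bm - 2 * cm - h ^ 2 * dm)) / h ^ 2
          + (dp + dm - 2 * d) := by
      field_simp
      ring
    rw [he]
    refine (abs_add_le _ _).trans (add_le_add ?_ Hd)
    rw [abs_div, abs_of_pos (by positivity : 0 < h ^ 2), div_le_iff₀ (by positivity)]
    refine (abs_add_le _ _).trans ((add_le_add Hp Hm).trans_eq (by ring))
  have hr2 := sq_nonneg r
  have hh2 := sq_nonneg h
  have hb₅' := sq_nonneg b₅
  refine ⟨(central H₁ hb₁).trans ?_, (central H₂ hb₂).trans ?_, ?_, ?_,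
    (second H₆p H₆m H₈).trans ?_, (second H₇p H₇m H₉).trans ?_⟩
  · gcongr; linarith
  · gcongr; linarith
  · have hle : b₃ * r ^ 2
        ≤ (b₁ + b₂ + b₃ + b₄ + b₅ ^ 2 + 2 * b₆ + 2 * b₇ + b₈ + b₉) * r ^ 2 :=
      mul_le_mul_of_nonneg_right (by linarith) hr2
    rw [abs_le] at *
    constructor <;> linarith
  · have hH := abs_Hcos_add_sin_midpoint_le (U (x, y, m + r)) (U (x, y, m - r))
    have hs := Real.abs_sin_sub_sin_le ((U (x, y, m + r) + U (x, y, m - r)) / 2) (U (x, y, m))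
    have hsq : (U (x, y, m + r) - U (x, y, m - r)) ^ 2 ≤ b₅ ^ 2 * r ^ 2 := by
      rw [← mul_pow, ← sq_abs]
      gcongr
    have hmid : |(U (x, y, m + r) + U (x, y, m - r)) / 2 - U (x, y, m)| ≤ b₄ * r ^ 2 := by
      have := mul_nonneg hb₄ hr2
      rw [abs_le] at *
      constructor <;> linarith
    have hle : (b₄ + b₅ ^ 2) * r ^ 2
        ≤ (b₁ + b₂ + b₃ + b₄ + b₅ ^ 2 + 2 * b₆ + 2 * b₇ + b₈ + b₉) * r ^ 2 :=
      mul_le_mul_of_nonneg_right (by linarith) hr2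
    replace hs := hs.trans hmid
    rw [abs_le] at hH hs ⊢
    constructor <;> linarith
  · rw [mul_add, add_comm]
    gcongr <;> linarith
  · rw [mul_add, add_comm]
    gcongr <;> linarith

/-- Lemma 4.1: the truncation errors `ρ` and `s` of the scheme are
`O(Δt² + h²)`, uniformly over interior grid points and time levels up to `T`. -/
theorem truncation_error_second_order
    (α β φ₀ : ℝ) (hα : 0 ≤ α) (hβ : 0 ≤ β) (hφ₀ : 0 ≤ φ₀)
    (T L : ℝ) (hT : 0 < T) (hL : 0 < L)
    (ue : ℝ → ℝ → ℝ → ℝ)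
    (hue : ContDiff ℝ 5 (fun p : ℝ × ℝ × ℝ => ue p.1 p.2.1 p.2.2)) :
    ∃ C : ℝ, 0 < C ∧
      ∀ (φ : ℝ → ℝ → ℝ), (∀ x y : ℝ, |φ x y| ≤ φ₀) →
      ∀ (M : ℕ), 2 ≤ M → 0 < L / M → L / M ≤ 1 →
      ∀ (Δt : ℝ), 0 < Δt → Δt ≤ 1 →
      ∀ (k i j : ℕ), ((k : ℝ) + 1) * Δt ≤ T → 1 ≤ i → i < M → 1 ≤ j → j < M →
        let h : ℝ := L / M
        let uG : ℕ → ℕ → ℕ → ℝ :=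
          fun k' i' j' => ue ((i' : ℝ) * h) ((j' : ℝ) * h) ((k' : ℝ) * Δt)
        let vG : ℕ → ℕ → ℕ → ℝ :=
          fun k' i' j' => deriv (ue ((i' : ℝ) * h) ((j' : ℝ) * h)) ((k' : ℝ) * Δt)
        |(vG (k + 1) i j - vG k i j) / Δt
            + β * (uG (k + 1) i j - uG k i j) / Δt
            - (α / 2) * lapH h (fun i' j' => uG (k + 1) i' j' + uG k i' j') i j
            - φ ((i : ℝ) * h) ((j : ℝ) * h) * Hcos (uG (k + 1) i j) (uG k i j)
            - Fforce α β φ ue ((i : ℝ) * h) ((j : ℝ) * h) ((k : ℝ) * Δt + Δt / 2)|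
          + |(uG (k + 1) i j - uG k i j) / Δt - (vG (k + 1) i j + vG k i j) / 2|
          ≤ C * (Δt ^ 2 + h ^ 2) := by
  obtain ⟨B, hB0, hB⟩ := exists_consistency_bounds hue T L
  have hue2 : ContDiff ℝ 2 (fun p : ℝ × ℝ × ℝ => ue p.1 p.2.1 p.2.2) :=
    hue.of_le (by norm_num)
  have hue1 : ContDiff ℝ 1 (fun p : ℝ × ℝ × ℝ => ue p.1 p.2.1 p.2.2) :=
    hue.of_le (by norm_num)
  refine ⟨(3 + β + α + φ₀) * B + 1, by positivity, ?_⟩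
  intro φ hφ M hM hhpos _ Δt hΔt _ k i j hk hi hiM hj hjM h uG vG
  have hMh : (M : ℝ) * h = L := by
    have : (M : ℝ) ≠ 0 := by positivity
    simp only [h]
    field_simp
  have hh : 0 < h := hhpos
  have lower {n : ℕ} (hn : 1 ≤ n) : h ≤ n * h :=
    le_mul_of_one_le_left hh.le (by exact_mod_cast hn)
  have upper {n : ℕ} (hn : n < M) : (n : ℝ) * h + h ≤ L := by
    have : (n : ℝ) + 1 ≤ M := by exact_mod_cast hn
    rw [← hMh]
    nlinarith
  have hkt : 0 ≤ (k : ℝ) * Δt := by positivity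
  obtain ⟨E₁, E₂, E₃, E₄, E₅, E₆⟩ := hB (i * h) (j * h) (k * Δt + Δt / 2) (Δt / 2) h
    (by positivity) hh (by linarith) (by linarith) (lower hi) (upper hiM) (lower hj) (upper hjM)
  set U := fun p : ℝ × ℝ × ℝ => ue p.1 p.2.1 p.2.2
  have hv (x y t : ℝ) : deriv (ue x y) t = dirDeriv (0, 0, 1) U (x, y, t) :=
    deriv_thd_eq_dirDeriv hue1 x y t
  have htt (x y t : ℝ) : iteratedDeriv 2 (ue x y) t
      = dirDeriv (0, 0, 1) (dirDeriv (0, 0, 1) U) (x, y, t) :=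
    iteratedDeriv_two_thd_eq_dirDeriv hue2 x y t
  have hxx (x y t : ℝ) : iteratedDeriv 2 (fun z => ue z y t) x
      = dirDeriv (1, 0, 0) (dirDeriv (1, 0, 0) U) (x, y, t) :=
    iteratedDeriv_two_fst_eq_dirDeriv hue2 x y t
  have hyy (x y t : ℝ) : iteratedDeriv 2 (fun z => ue x z t) y
      = dirDeriv (0, 1, 0) (dirDeriv (0, 1, 0) U) (x, y, t) :=
    iteratedDeriv_two_snd_eq_dirDeriv hue2 x y t
  have hp : (k : ℝ) * Δt + Δt / 2 + Δt / 2 = ((k + 1 : ℕ) : ℝ) * Δt := by push_cast; ring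
  have hm : (k : ℝ) * Δt + Δt / 2 - Δt / 2 = (k : ℝ) * Δt := by ring
  have next (n : ℕ) : (n : ℝ) * h + h = ((n + 1 : ℕ) : ℝ) * h := by push_cast; ring
  have prev {n : ℕ} (hn : 1 ≤ n) : (n : ℝ) * h - h = ((n - 1 : ℕ) : ℝ) * h := by
    push_cast [Nat.cast_sub hn]; ring
  rw [← hv, ← hv, ← htt, hp, hm, mul_div_cancel₀ _ (two_ne_zero' ℝ)] at E₁
  rw [← hv, hp, hm, mul_div_cancel₀ _ (two_ne_zero' ℝ)] at E₂
  rw [← hv, ← hv, ← hv, hp, hm] at E₃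
  rw [hp, hm] at E₄
  rw [← hxx, hp, hm, next, prev hi] at E₅
  rw [← hyy, hp, hm, next, prev hj] at E₆
  simp only at E₁ E₂ E₃ E₄ E₅ E₆
  have weighted {c d e b : ℝ} (hc : |c| ≤ d) (he : |e| ≤ b) : |c * e| ≤ d * b := by
    rw [abs_mul]
    exact mul_le_mul hc he (abs_nonneg _) ((abs_nonneg _).trans hc)
  have combine {e₁ e₂ e₄ e₅ e₆ w b b' : ℝ} (h₁ : |e₁| ≤ b) (h₂ : |e₂| ≤ b) (h₄ : |e₄| ≤ b)
      (h₅ : |e₅| ≤ b') (h₆ : |e₆| ≤ b') (hw : |w| ≤ φ₀) :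
      |e₁ + β * e₂ - α / 2 * e₅ - α / 2 * e₆ + w * e₄| ≤ b + β * b + α * b' + φ₀ * b := by
    have i₂ := weighted (abs_of_nonneg hβ).le h₂
    have i₄ := weighted hw h₄
    have i₅ := weighted (abs_of_nonneg (by positivity : 0 ≤ α / 2)).le h₅
    have i₆ := weighted (abs_of_nonneg (by positivity : 0 ≤ α / 2)).le h₆
    rw [abs_le] at *
    constructor <;> linarith
  have hr2 := mul_nonneg hB0 (sq_nonneg Δt)
  have hh2 := mul_nonneg hB0 (sq_nonneg h)
  have hα1 := mul_nonneg hα hr2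
  have hα2 := mul_nonneg hα hh2
  have hβ1 := mul_nonneg hβ hr2
  have hβ2 := mul_nonneg hβ hh2
  have hφ1 := mul_nonneg hφ₀ hr2
  have hφ2 := mul_nonneg hφ₀ hh2
  have hρ : |(vG (k + 1) i j - vG k i j) / Δt
            + β * (uG (k + 1) i j - uG k i j) / Δt
            - (α / 2) * lapH h (fun i' j' => uG (k + 1) i' j' + uG k i' j') i j
            - φ ((i : ℝ) * h) ((j : ℝ) * h) * Hcos (uG (k + 1) i j) (uG k i j)
            - Fforce α β φ ue ((i : ℝ) * h) ((j : ℝ) * h) ((k : ℝ) * Δt + Δt / 2)|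
      ≤ B * (Δt / 2) ^ 2 + β * (B * (Δt / 2) ^ 2) + α * (B * ((Δt / 2) ^ 2 + h ^ 2))
        + φ₀ * (B * (Δt / 2) ^ 2) := by
    refine le_of_eq_of_le (congrArg _ ?_) (combine E₁ E₂ E₄ E₅ E₆ (hφ (i * h) (j * h)))
    simp only [uG, vG, lapH, Fforce]
    ring
  have hs : |(uG (k + 1) i j - uG k i j) / Δt - (vG (k + 1) i j + vG k i j) / 2|
      ≤ 2 * (B * (Δt / 2) ^ 2) := by
    simp only [uG, vG]
    rw [abs_le] at *
    constructor <;> linarith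
  refine (add_le_add hρ hs).trans ?_
  nlinarith [sq_nonneg Δt, sq_nonneg h]
end
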